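/- Let P be a non-constant complex polynomial with P(0) = 0. Then the map from C^∞(ℝ, ℂ) to itself sending f to the function x ↦ P(f(x)) has dense range: for every g ∈ C^∞(ℝ,ℂ), every k ∈ ℕ and every ε > 0 there exists f ∈ C^∞(ℝ,ℂ) with P_k(P∘f − g) < ε. -/

import Mathlib

open Set Polynomial

/-- A smooth curve in `ℂ` has arbitrarily small translates avoiding a given countable set. -/
theorem exists_norm_lt_forall_add_notMem {g : ℝ → ℂ} (hg : ContDiff ℝ 1 g) {V : Set ℂ}
    (hV : V.Countable) {ε : ℝ} (hε : 0 < ε) : ∃ c : ℂ, ‖c‖ < ε ∧ ∀ t, g t + c ∉ V := by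
  have hdim : dimH (⋃ v ∈ V, range fun t => v - g t) < Module.finrank ℝ ℂ := by
    rw [dimH_bUnion hV]
    refine lt_of_le_of_lt (b := (1 : ENNReal)) (iSup₂_le fun v _ => ?_) ?_
    · have h : ContDiff ℝ 1 fun t => v - g t := contDiff_const.sub hg
      simpa using h.dimH_range_le
    · simp [Complex.finrank_real_complex]
  obtain ⟨c, hc, hcε⟩ := (dense_compl_of_dimH_lt_finrank hdim).exists_dist_lt 0 hε
  refine ⟨c, by simpa using hcε, fun t ht => hc ?_⟩
  exact mem_iUnion₂.2 ⟨g t + c, ht, t, by simp⟩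

/-- A continuous lift of a smooth map through a polynomial is smooth where the derivative of the
polynomial does not vanish. -/
theorem Polynomial.contDiffAt_of_eval_comp (P : ℂ[X]) {E : Type*} [NormedAddCommGroup E]
    [NormedSpace ℝ E] {f : E → ℂ} {x : E} {n : WithTop ℕ∞} (hf : ContinuousAt f x)
    (hP : P.derivative.eval (f x) ≠ 0) (h : ContDiffAt ℝ n (fun y => P.eval (f y)) x) :
    ContDiffAt ℝ n f x := by
  have hd : deriv (fun z => P.eval z) (f x) ≠ 0 := by rwa [P.deriv]
  have ha : AnalyticAt ℂ (fun z => P.eval z) (f x) := P.differentiable.analyticAt _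
  have hinv : ContDiffAt ℝ n (ha.hasStrictDerivAt.localInverse _ _ _ hd) (P.eval (f x)) :=
    (ha.analyticAt_localInverse hd).contDiffAt.restrict_scalars ℝ
  refine (hinv.comp x h).congr_of_eventuallyEq ?_
  filter_upwards [hf.eventually (ha.hasStrictDerivAt.eventually_left_inverse hd)] with y hy
  exact hy.symm

/-- A smooth curve in `ℂ` avoiding the critical values of a nonconstant polynomial lifts to a
smooth curve through that polynomial. -/
theorem Polynomial.exists_contDiff_eval_comp_eq (P : ℂ[X]) (hP : 0 < P.natDegree) {h : ℝ → ℂ}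
    {n : WithTop ℕ∞} (hh : ContDiff ℝ n h)
    (hcrit : ∀ t, h t ∉ P.eval '' {z | P.derivative.eval z = 0}) :
    ∃ f : ℝ → ℂ, ContDiff ℝ n f ∧ ∀ t, P.eval (f t) = h t := by
  obtain ⟨z, hz⟩ := IsAlgClosed.eval_surjective hP.ne' (h 0)
  obtain ⟨F, ⟨-, hF⟩, -⟩ := P.isCoveringMapOn_eval.existsUnique_continuousMap_lifts
    ⟨h, hh.continuous⟩ (a₀ := 0) hz hcrit
  have hF' (t : ℝ) : P.eval (F t) = h t := congrFun hF t
  refine ⟨F, contDiff_iff_contDiffAt.2 fun t => ?_, hF'⟩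
  refine P.contDiffAt_of_eval_comp F.continuous.continuousAt (fun h0 => ?_) ?_
  · exact hcrit t ⟨F t, h0, hF' t⟩
  · simpa only [hF'] using hh.contDiffAt

/-- Proposition 14 of the paper. If `P` is a non-constant complex
polynomial with `P(0) = 0`, then `f ↦ P ∘ f` has dense range on `C^∞(ℝ, ℂ)` (density with
respect to the seminorms `P_k(f) = max_{0 ≤ j ≤ k} max_{t ∈ [-k,k]} |f⁽ʲ⁾(t)|`). -/
theorem stmt16 (P : Polynomial ℂ) (hP : 0 < P.natDegree) (h0 : P.coeff 0 = 0)
    (g : ℝ → ℂ) (hg : ContDiff ℝ (⊤ : ℕ∞) g) (k : ℕ) (ε : ℝ) (hε : 0 < ε) :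
    ∃ f : ℝ → ℂ, ContDiff ℝ (⊤ : ℕ∞) f ∧
      ∀ j ≤ k, ∀ t ∈ Icc (-(k:ℝ)) (k:ℝ),
        ‖iteratedDeriv j (fun x => P.eval (f x)) t - iteratedDeriv j g t‖ < ε := by
  have hd : P.derivative ≠ 0 := fun h => hP.ne' (derivative_eq_zero.1 h)
  have hV : (P.eval '' {z | P.derivative.eval z = 0}).Countable :=
    (P.derivative.finite_setOfPred_isRoot hd).countable.image _
  obtain ⟨c, hc, hcV⟩ := exists_norm_lt_forall_add_notMem (hg.of_le (by simp)) hV hε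
  obtain ⟨f, hf, hPf⟩ := P.exists_contDiff_eval_comp_eq hP (hg.add contDiff_const) hcV
  refine ⟨f, hf, fun j _ t _ => ?_⟩
  simp only [hPf]
  obtain _ | j := j
  · simpa using hc
  · simpa [iteratedDeriv_succ'] using hε
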